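/- Let c_1,…,c_N ∈ V^* and u_1,…,u_N ∈ V ⊗_k A, and assume N < 2·dim_k V. Then str_A((ι_{c_1} + u_1∧(−)) ∘ (ι_{c_2} + u_2∧(−)) ∘ ⋯ ∘ (ι_{c_N} + u_N∧(−))) = 0. (This supertrace identity expresses the vanishing of the Chern character of a Koszul matrix factorization {a,b} of rank r in n variables with b given by linear forms, whenever r > n/2.) -/

import Mathlib

open TensorProduct

/-- The supertrace `str_A(T) = tr_A(ε ∘ T)` of an `A`-linear endomorphism of `A ⊗ₖ ⋀V`,
where `ε` is the parity (grade) involution. -/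
noncomputable def superTrace (k : Type*) [Field k] (A : Type*) [CommRing A] [Algebra k A]
    (V : Type*) [AddCommGroup V] [Module k V]
    (T : (A ⊗[k] ExteriorAlgebra k V) →ₗ[A] (A ⊗[k] ExteriorAlgebra k V)) : A :=
  LinearMap.trace A (A ⊗[k] ExteriorAlgebra k V)
    ((LinearMap.baseChange A
        (CliffordAlgebra.involute (Q := (0 : QuadraticForm k V))).toLinearMap) ∘ₗ T)

/-- Left exterior multiplication by `u ∈ A ⊗ₖ V` on `A ⊗ₖ ⋀V`. -/
noncomputable def wedgeOp (k : Type*) [Field k] (A : Type*) [CommRing A] [Algebra k A]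
    (V : Type*) [AddCommGroup V] [Module k V] (u : A ⊗[k] V) :
    (A ⊗[k] ExteriorAlgebra k V) →ₗ[A] (A ⊗[k] ExteriorAlgebra k V) :=
  LinearMap.mulLeft A (LinearMap.baseChange A (ExteriorAlgebra.ι k (M := V)) u)

/-- The contraction `ι_c` by `c ∈ V^*`, base changed to `A ⊗ₖ ⋀V`. -/
noncomputable def contrOp (k : Type*) [Field k] (A : Type*) [CommRing A] [Algebra k A]
    (V : Type*) [AddCommGroup V] [Module k V] (c : Module.Dual k V) :
    (A ⊗[k] ExteriorAlgebra k V) →ₗ[A] (A ⊗[k] ExteriorAlgebra k V) :=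
  LinearMap.baseChange A
    (CliffordAlgebra.contractLeft (Q := (0 : QuadraticForm k V)) c)

section RingWithTrace

variable {R B : Type*} [Ring R] [AddCommGroup B]

lemma List.mul_prod_of_anticomm {g : R} {l : List R} (h : ∀ x ∈ l, g * x = -(x * g)) :
    g * l.prod = (-1) ^ l.length * (l.prod * g) := by
  induction l with
  | nil => simp
  | cons x l ih =>
    rw [List.forall_mem_cons] at h
    rw [List.prod_cons, ← mul_assoc, h.1, neg_mul, mul_assoc, ih h.2, List.length_cons, pow_succ,
      ← mul_assoc x, ((Commute.neg_one_left x).pow_left l.length).eq.symm]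
    noncomm_ring

lemma List.mul_prod_of_parity_switch {p : R} {l : List R} (h : ∀ x ∈ l, p * x + x * p = x) :
    (Even l.length → p * l.prod = l.prod * p) ∧
      (Odd l.length → p * l.prod = l.prod * (1 - p)) := by
  induction l with
  | nil => simp
  | cons x l ih =>
    rw [List.forall_mem_cons] at h
    have hx : p * x = x * (1 - p) := by rw [mul_sub, mul_one, eq_sub_iff_add_eq, h.1]
    simp only [List.length_cons, Nat.even_add_one, Nat.odd_add_one, Nat.not_even_iff_odd,
      Nat.not_odd_iff_even, List.prod_cons, ← mul_assoc, hx]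
    refine ⟨fun hl ↦ ?_, fun hl ↦ ?_⟩
    · rw [mul_assoc, sub_mul, one_mul, (ih h.2).2 hl]
      noncomm_ring
    · rw [mul_assoc, sub_mul, one_mul, (ih h.2).1 hl]
      noncomm_ring

/-- A cyclic functional kills `e * l.prod` for an odd list `l` of elements which interchange the
idempotent `p` and its complement. -/
lemma map_mul_prod_eq_zero_of_odd {t : R →+ B} (ht : ∀ x y, t (x * y) = t (y * x)) {p e : R}
    (hp : p * p = p) (hpe : p * e = e * p) {l : List R} (h : ∀ x ∈ l, p * x + x * p = x)
    (hl : Odd l.length) : t (e * l.prod) = 0 := by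
  have hw := (List.mul_prod_of_parity_switch h).2 hl
  have hq : (1 - p) * (1 - p) = 1 - p := by rw [mul_sub, mul_one, sub_mul, one_mul, hp]; simp
  have hw' : (1 - p) * l.prod = l.prod * p := by
    rw [sub_mul, one_mul, hw]; noncomm_ring
  have h₁ : t (e * l.prod * p) = 0 := by
    calc t (e * l.prod * p) = t (e * l.prod * p * p) := by rw [mul_assoc _ p p, hp]
      _ = t (p * e * (l.prod * p)) := by rw [ht]; simp only [mul_assoc]
      _ = t (e * (p * (1 - p)) * l.prod) := by rw [hpe, ← hw']; simp only [mul_assoc]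
      _ = 0 := by rw [mul_sub, hp]; simp
  have h₂ : t (e * l.prod * (1 - p)) = 0 := by
    calc t (e * l.prod * (1 - p)) = t (e * l.prod * (1 - p) * (1 - p)) := by
          rw [mul_assoc _ (1 - p) (1 - p), hq]
      _ = t ((1 - p) * e * (l.prod * (1 - p))) := by rw [ht]; simp only [mul_assoc]
      _ = t (e * ((1 - p) * p) * l.prod) := by
          rw [sub_mul, hpe, one_mul, ← hw]; congr 1; noncomm_ring
      _ = 0 := by rw [sub_mul, hp]; simp
  rw [mul_sub, mul_one, map_sub, h₁, sub_zero] at h₂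
  exact h₂

/-- A cyclic functional kills `e * l.prod` for an even list `l` of elements anticommuting with `g`,
if `g` anticommutes with `e` and `g * g' + g' * g = 1`. -/
lemma map_mul_prod_eq_zero_of_even {t : R →+ B} (ht : ∀ x y, t (x * y) = t (y * x)) {g g' e : R}
    (hg : g * g' + g' * g = 1) (hge : g * e = -(e * g)) {l : List R}
    (h : ∀ x ∈ l, g * x = -(x * g)) (hl : Even l.length) : t (e * l.prod) = 0 := by
  have hw : g * l.prod = l.prod * g := by
    rw [List.mul_prod_of_anticomm h, hl.neg_one_pow, one_mul]
  have key : t (e * l.prod * (g' * g)) = -t (e * l.prod * (g * g')) := by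
    rw [← mul_assoc, ht, ← map_neg]
    congr 1
    rw [← mul_assoc, ← mul_assoc, hge, neg_mul, mul_assoc e, hw]
    noncomm_ring
  rw [← mul_one (e * l.prod), ← hg, mul_add, map_add, key, add_neg_cancel]

end RingWithTrace

namespace ExteriorAlgebra

variable {k V : Type*} [Field k] [AddCommGroup V] [Module k V]

/-- Contraction by `c` as an endomorphism of the exterior algebra. -/
noncomputable abbrev contr (c : Module.Dual k V) : Module.End k (ExteriorAlgebra k V) :=
  CliffordAlgebra.contractLeft (Q := (0 : QuadraticForm k V)) c

/-- Left exterior multiplication by `v`. -/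
noncomputable abbrev wedge (v : V) : Module.End k (ExteriorAlgebra k V) :=
  LinearMap.mulLeft k (ι k v)

/-- The parity involution as a linear endomorphism. -/
noncomputable abbrev parity : Module.End k (ExteriorAlgebra k V) :=
  (CliffordAlgebra.involute (Q := (0 : QuadraticForm k V))).toLinearMap

lemma contr_ι_mul (c : Module.Dual k V) (v : V) (x : ExteriorAlgebra k V) :
    contr c (ι k v * x) = c v • x - ι k v * contr c x :=
  CliffordAlgebra.contractLeft_ι_mul _ _ _

lemma parity_ι_mul (v : V) (x : ExteriorAlgebra k V) :
    parity (ι k v * x) = -(ι k v * parity x) := by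
  refine (map_mul CliffordAlgebra.involute _ x).trans ?_
  exact (congrArg (· * _) (CliffordAlgebra.involute_ι v)).trans (neg_mul _ _)

lemma end_ext {f g : Module.End k (ExteriorAlgebra k V)} (h1 : f 1 = g 1)
    (h : ∀ x v, f x = g x → f (ι k v * x) = g (ι k v * x)) : f = g := by
  refine LinearMap.ext fun x ↦ ?_
  induction x using CliffordAlgebra.left_induction with
  | algebraMap r =>
    rw [Algebra.algebraMap_eq_smul_one, map_smul, map_smul]
    exact congrArg (r • ·) h1
  | add x y hx hy => rw [map_add, map_add, hx, hy]
  | ι_mul x v hx => exact h x v hx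

lemma contr_one (c : Module.Dual k V) : contr c 1 = 0 :=
  CliffordAlgebra.contractLeft_one _ _

lemma parity_one : parity (1 : ExteriorAlgebra k V) = 1 :=
  map_one CliffordAlgebra.involute

lemma contr_mul_contr (c d : Module.Dual k V) : contr c * contr d = -(contr d * contr c) := by
  refine LinearMap.ext fun x ↦ ?_
  exact CliffordAlgebra.contractLeft_comm _ _ _

lemma wedge_mul_wedge (v w : V) : wedge (k := k) v * wedge w = -(wedge w * wedge v) := by
  refine LinearMap.ext fun x ↦ ?_
  simp only [Module.End.mul_apply, LinearMap.mulLeft_apply, LinearMap.neg_apply, ← mul_assoc]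
  rw [← neg_mul, eq_neg_of_add_eq_zero_left (ι_add_mul_swap v w)]

lemma contr_mul_wedge (c : Module.Dual k V) (v : V) :
    contr c * wedge v = c v • 1 - wedge v * contr c := by
  refine LinearMap.ext fun x ↦ ?_
  exact contr_ι_mul c v x

lemma wedge_mul_parity (v : V) : wedge (k := k) v * parity = -(parity * wedge v) := by
  refine LinearMap.ext fun x ↦ ?_
  simp only [Module.End.mul_apply, LinearMap.mulLeft_apply, LinearMap.neg_apply, parity_ι_mul,
    neg_neg]

lemma contr_mul_parity (c : Module.Dual k V) : contr c * parity = -(parity * contr c) := by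
  refine end_ext ?_ fun x v hx ↦ ?_
  · simp only [Module.End.mul_apply, LinearMap.neg_apply, contr_one, parity_one, map_zero, neg_zero]
  · simp only [Module.End.mul_apply, LinearMap.neg_apply] at hx ⊢
    rw [parity_ι_mul, map_neg, contr_ι_mul, contr_ι_mul, map_sub, parity_ι_mul, hx, map_smul]
    noncomm_ring

/-- A linear projection of the exterior algebra onto its even part. -/
lemma exists_even_projection : ∃ p : Module.End k (ExteriorAlgebra k V),
    p 1 = 1 ∧ ∀ v x, p (ι k v * x) = ι k v * (x - p x) := by
  let Λ := ExteriorAlgebra k V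
  let f : V →ₗ[k] (Λ × Λ) →ₗ[k] (Λ × Λ) :=
    LinearMap.mk₂ k (fun v x ↦ (ι k v * x.2, ι k v * x.1))
      (by intros; simp [add_mul]) (by intros; simp) (by intros; simp [mul_add]) (by intros; simp)
  have hf : ∀ v x, f v (f v x) = (0 : QuadraticForm k V) v • x := by
    intro v x
    simp [f, ← mul_assoc]
  let F : Λ →ₗ[k] Λ × Λ := CliffordAlgebra.foldr (0 : QuadraticForm k V) f hf (1, 0)
  have h1 : F 1 = (1, 0) := CliffordAlgebra.foldr_one _ _ _ _
  have hι : ∀ v x, F (ι k v * x) = f v (F x) := fun v x ↦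
    (CliffordAlgebra.foldr_mul _ _ _ _ _ _).trans (CliffordAlgebra.foldr_ι _ _ _ _ _)
  have hsum : LinearMap.fst k Λ Λ ∘ₗ F + LinearMap.snd k Λ Λ ∘ₗ F = LinearMap.id := by
    refine end_ext ?_ fun x v hx ↦ ?_
    · simp [h1]
    · simp only [LinearMap.add_apply, LinearMap.comp_apply, LinearMap.fst_apply,
        LinearMap.snd_apply, LinearMap.id_apply] at hx ⊢
      rw [hι]
      simp only [f, LinearMap.mk₂_apply]
      rw [← mul_add, add_comm, hx]
  refine ⟨LinearMap.fst k Λ Λ ∘ₗ F, by simp [h1], fun v x ↦ ?_⟩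
  have hx : (F x).1 + (F x).2 = x := LinearMap.congr_fun hsum x
  simp only [LinearMap.comp_apply, LinearMap.fst_apply, hι, f, LinearMap.mk₂_apply]
  rw [← eq_sub_of_add_eq' hx]

section EvenProjection

variable {p : Module.End k (ExteriorAlgebra k V)}

lemma even_projection_mul_self (h1 : p 1 = 1)
    (hι : ∀ v x, p (ι k v * x) = ι k v * (x - p x)) :
    p * p = p := by
  refine end_ext (by simp [h1]) fun x v hx ↦ ?_
  rw [Module.End.mul_apply] at hx ⊢
  rw [hι, hι, map_sub, hx, sub_self, sub_zero]

lemma even_projection_mul_parity (h1 : p 1 = 1)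
    (hι : ∀ v x, p (ι k v * x) = ι k v * (x - p x)) :
    p * parity = parity * p := by
  refine end_ext ?_ fun x v hx ↦ ?_
  · simp only [Module.End.mul_apply, h1, parity_one]
  · simp only [Module.End.mul_apply] at hx ⊢
    rw [hι, parity_ι_mul, parity_ι_mul, map_neg, hι, map_sub, hx]

lemma even_projection_wedge (hι : ∀ v x, p (ι k v * x) = ι k v * (x - p x)) (v : V) :
    p * wedge v + wedge v * p = wedge v := by
  refine LinearMap.ext fun x ↦ ?_
  simp only [Module.End.mul_apply, LinearMap.add_apply, LinearMap.mulLeft_apply, hι, mul_sub,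
    sub_add_cancel]

lemma even_projection_contr (h1 : p 1 = 1)
    (hι : ∀ v x, p (ι k v * x) = ι k v * (x - p x))
    (c : Module.Dual k V) : p * contr c + contr c * p = contr c := by
  refine end_ext ?_ fun x v hx ↦ ?_
  · simp only [Module.End.mul_apply, LinearMap.add_apply, h1, contr_one, map_zero, add_zero]
  · simp only [Module.End.mul_apply, LinearMap.add_apply] at hx ⊢
    rw [hι, contr_ι_mul, contr_ι_mul, map_sub, map_sub, map_smul, hι, ← eq_sub_of_add_eq hx]
    simp only [smul_sub, mul_sub]
    abel

end EvenProjection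

variable {I : Type*} (b : Module.Basis I k V)

/-- The contractions and exterior multiplications attached to a basis, which generate the
endomorphism algebra of the exterior algebra. -/
noncomputable def cliffordGen : I ⊕ I → Module.End k (ExteriorAlgebra k V) :=
  Sum.elim (fun i ↦ contr (b.coord i)) fun i ↦ wedge (b i)

lemma cliffordGen_anticomm {i j : I ⊕ I} (h : i ≠ j.swap) :
    cliffordGen b i * cliffordGen b j = -(cliffordGen b j * cliffordGen b i) := by
  classical
  rcases i with i | i <;> rcases j with j | j
  · exact contr_mul_contr _ _
  · have : j ≠ i := fun e ↦ h (by simp [e])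
    simp [cliffordGen, contr_mul_wedge, this]
  · have : i ≠ j := fun e ↦ h (by simp [e])
    simp [cliffordGen, contr_mul_wedge, this]
  · exact wedge_mul_wedge _ _

lemma cliffordGen_mul_swap (i : I ⊕ I) :
    cliffordGen b i * cliffordGen b i.swap + cliffordGen b i.swap * cliffordGen b i = 1 := by
  rcases i with i | i <;> simp [cliffordGen, contr_mul_wedge]

lemma cliffordGen_mul_parity (i : I ⊕ I) :
    cliffordGen b i * parity = -(parity * cliffordGen b i) := by
  rcases i with i | i
  · exact contr_mul_parity _
  · exact wedge_mul_parity _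

/-- A cyclic functional kills the product of the parity involution with any word in the Clifford
generators from which some generator is absent. -/
lemma map_parity_mul_prod_cliffordGen {B : Type*} [AddCommGroup B]
    {t : Module.End k (ExteriorAlgebra k V) →+ B} (ht : ∀ x y, t (x * y) = t (y * x)) {N : ℕ}
    {r : Fin N → I ⊕ I} (hr : ¬ Function.Surjective r) :
    t (parity * (List.ofFn fun i ↦ cliffordGen b (r i)).prod) = 0 := by
  rcases Nat.even_or_odd N with hN | hN
  · obtain ⟨m, hm⟩ := not_forall.1 hr
    refine map_mul_prod_eq_zero_of_even ht (cliffordGen_mul_swap b m.swap)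
      (cliffordGen_mul_parity b _) ?_ (by simpa using hN)
    intro x hx
    obtain ⟨i, rfl⟩ := (List.mem_ofFn' _ _).1 hx
    exact cliffordGen_anticomm b fun e ↦ hm ⟨i, Sum.swap_leftInverse.injective e.symm⟩
  · obtain ⟨p, h1, hι⟩ := exists_even_projection (k := k) (V := V)
    refine map_mul_prod_eq_zero_of_odd ht (even_projection_mul_self h1 hι)
      (even_projection_mul_parity h1 hι) ?_ (by simpa using hN)
    intro x hx
    obtain ⟨i, rfl⟩ := (List.mem_ofFn' _ _).1 hx
    change p * cliffordGen b (r i) + cliffordGen b (r i) * p = cliffordGen b (r i)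
    rcases r i with j | j
    · exact even_projection_contr h1 hι _
    · exact even_projection_wedge hι _

end ExteriorAlgebra

open ExteriorAlgebra in
lemma contrOp_add_wedgeOp_eq_sum {k A V I : Type*} [Field k] [CommRing A] [Algebra k A]
    [AddCommGroup V] [Module k V] [Fintype I] (b : Module.Basis I k V)
    (c : Module.Dual k V) (u : A ⊗[k] V) :
    contrOp k A V c + wedgeOp k A V u =
      ∑ j : I ⊕ I, Sum.elim (fun i ↦ algebraMap k A (c (b i))) ((b.baseChange A).repr u) j •
        LinearMap.baseChange A (cliffordGen b j) := by
  classical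
  rw [Fintype.sum_sum_type]
  simp only [Sum.elim_inl, Sum.elim_inr, cliffordGen]
  congr 1
  · have hc : c = ∑ i, c (b i) • b.coord i := b.ext fun j ↦ by simp
    have hs : contr c = ∑ i, c (b i) • contr (b.coord i) := by
      conv_lhs => rw [hc]
      simp only [contr, map_sum, map_smul]
    change LinearMap.baseChange A (contr c) = _
    rw [hs, ← LinearMap.baseChangeHom_apply, map_sum]
    simp only [map_smul, LinearMap.baseChangeHom_apply, algebraMap_smul]
  · conv_lhs => rw [← (b.baseChange A).sum_repr u]
    have hw : ∀ i, wedgeOp k A V ((b.baseChange A) i) = LinearMap.baseChange A (wedge (b i)) := by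
      intro i
      ext x
      simp [wedgeOp]
    simp only [← hw]
    simp only [wedgeOp, map_sum, map_smul]
    ext x
    simp [Finset.sum_mul]

/-- for `c₁,…,c_N ∈ V^*` and `u₁,…,u_N ∈ V ⊗ₖ A` with `N < 2·dim_k V`, the
supertrace `str_A((ι_{c₁} + u₁∧)∘⋯∘(ι_{c_N} + u_N∧))` vanishes. -/
theorem stmt11 {k : Type*} [Field k] {V : Type*} [AddCommGroup V] [Module k V]
    [FiniteDimensional k V] {A : Type*} [CommRing A] [Algebra k A]
    (N : ℕ) (hN : N < 2 * Module.finrank k V)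
    (c : Fin N → Module.Dual k V) (u : Fin N → A ⊗[k] V) :
    superTrace k A V (List.ofFn fun i => contrOp k A V (c i) + wedgeOp k A V (u i)).prod
      = 0 := by
  let b := Module.finBasis k V
  let s : (A ⊗[k] ExteriorAlgebra k V →ₗ[A] A ⊗[k] ExteriorAlgebra k V) →ₗ[A] A :=
    LinearMap.trace A _ ∘ₗ LinearMap.mulLeft A (LinearMap.baseChange A ExteriorAlgebra.parity)
  let φ := Module.End.baseChangeHom k A (ExteriorAlgebra k V)
  let t : Module.End k (ExteriorAlgebra k V) →+ A :=
    (LinearMap.trace A (A ⊗[k] ExteriorAlgebra k V)).toAddMonoidHom.comp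
      φ.toRingHom.toAddMonoidHom
  have ht : ∀ x y, t (x * y) = t (y * x) := fun x y ↦ by
    change LinearMap.trace A _ (φ (x * y)) = LinearMap.trace A _ (φ (y * x))
    rw [map_mul φ, map_mul φ, LinearMap.trace_mul_comm]
  change s _ = 0
  simp only [contrOp_add_wedgeOp_eq_sum b]
  rw [← MultilinearMap.mkPiAlgebraFin_apply (R := A), MultilinearMap.map_sum, map_sum]
  refine Finset.sum_eq_zero fun r _ ↦ ?_
  rw [MultilinearMap.map_smul_univ, map_smul, MultilinearMap.mkPiAlgebraFin_apply]
  have hr : ¬ Function.Surjective r := fun h ↦ by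
    have := Fintype.card_le_of_surjective r h
    simp only [Fintype.card_sum, Fintype.card_fin] at this
    omega
  have key : s (List.ofFn fun i ↦ LinearMap.baseChange A (ExteriorAlgebra.cliffordGen b (r i))).prod =
      t (ExteriorAlgebra.parity * (List.ofFn fun i ↦ ExteriorAlgebra.cliffordGen b (r i)).prod) := by
    change _ = LinearMap.trace A _ (φ _)
    rw [map_mul φ, map_list_prod φ, List.map_ofFn]
    rfl
  rw [key, ExteriorAlgebra.map_parity_mul_prod_cliffordGen b ht hr, smul_zero]
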